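/- Let A ∈ M(n,ℤ) and let μ be a Borel probability measure on 𝕋ⁿ = ℝⁿ/ℤⁿ that is invariant and strongly mixing under the ×A map T_A, and suppose there exist matrices B₁, …, Bₙ ∈ GL(n,ℤ) strongly independent over ℤⁿ∖{0} and an infinite set E ⊆ ℕ such that μ is invariant under the ×(Aʲ + Bᵢ) map for every j ∈ E and every i = 1, …, n. Then μ is either a Dirac point measure or the Lebesgue (Haar) measure on 𝕋ⁿ. -/

import Mathlib

open MeasureTheory Filter Matrix

noncomputable section

/-- The `n`-torus `ℝⁿ/ℤⁿ`. -/
abbrev Torus (n : ℕ) : Type := Fin n → AddCircle (1 : ℝ)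

/-- The `×A` map `T_A : 𝕋ⁿ → 𝕋ⁿ`, `x ↦ A x mod ℤⁿ`. -/
def mulMap {n : ℕ} (A : Matrix (Fin n) (Fin n) ℤ) (x : Torus n) : Torus n :=
  fun i => ∑ j, A i j • x j

/-- The Fourier coefficient `μ̂(k) = ∫ z₁^{k₁} ⋯ zₙ^{kₙ} dμ`. -/
def fourierCoef {n : ℕ} (μ : Measure (Torus n)) (k : Fin n → ℤ) : ℂ :=
  ∫ x : Torus n, ∏ i, fourier (k i) (x i) ∂μ

/-- A Følner sequence in `ℕ`. -/
def IsFolner (F : ℕ → Finset ℕ) : Prop :=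
  ∀ r : ℕ,
    Tendsto (fun m => ((symmDiff ((F m).image (· + r)) (F m)).card : ℝ) / (F m).card)
      atTop (nhds 0)

/-- Matrices `B₁, …, Bₙ` are strongly independent over `ℤⁿ \ {0}` if for every nonzero
row vector `k ∈ ℤⁿ` the row vectors `kB₁, …, kBₙ` are linearly independent over `ℝ`. -/
def StronglyIndependent {n : ℕ} (B : Fin n → Matrix (Fin n) (Fin n) ℤ) : Prop :=
  ∀ k : Fin n → ℤ, k ≠ 0 →
    LinearIndependent ℝ fun i : Fin n => fun j : Fin n => ((k ᵥ* B i) j : ℝ)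

/-- Strong mixing of a map `T` with respect to a measure `μ`. -/
def StronglyMixing {X : Type*} [MeasurableSpace X] (T : X → X) (μ : Measure X) : Prop :=
  ∀ S U : Set X, MeasurableSet S → MeasurableSet U →
    Tendsto (fun j => μ (T^[j] ⁻¹' S ∩ U)) atTop (nhds (μ S * μ U))

/-- The (topological) support of a measure: points all of whose open neighbourhoods have
positive measure; it is the smallest closed set of full measure. -/
def measSupport {X : Type*} [TopologicalSpace X] [MeasurableSpace X] (μ : Measure X) : Set X :=
  {x | ∀ U : Set X, IsOpen U → x ∈ U → 0 < μ U}

section Torus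

variable {n : ℕ}

theorem continuous_mulMap (A : Matrix (Fin n) (Fin n) ℤ) : Continuous (mulMap A) := by
  unfold mulMap
  fun_prop

theorem mulMap_mul (A B : Matrix (Fin n) (Fin n) ℤ) (x : Torus n) :
    mulMap (A * B) x = mulMap A (mulMap B x) := by
  ext i
  simp only [mulMap, Matrix.mul_apply, Finset.sum_smul, Finset.smul_sum, mul_smul]
  exact Finset.sum_comm

theorem mulMap_smul_one (d : ℤ) (x : Torus n) :
    mulMap (d • (1 : Matrix (Fin n) (Fin n) ℤ)) x = d • x := by
  ext i
  simp [mulMap, Matrix.one_apply, ite_smul]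

theorem mulMap_zero_right (A : Matrix (Fin n) (Fin n) ℤ) : mulMap A 0 = 0 := by
  ext i
  simp [mulMap]

theorem mulMap_pow (A : Matrix (Fin n) (Fin n) ℤ) (j : ℕ) :
    mulMap (A ^ j) = (mulMap A)^[j] := by
  induction j with
  | zero =>
    ext x : 1
    simpa using mulMap_smul_one 1 x
  | succ j ih =>
    ext x : 1
    rw [pow_succ, mulMap_mul, ih, Function.iterate_succ_apply]

theorem mFourier_eq_toCircle (k : Fin n → ℤ) (x : Torus n) :
    UnitAddTorus.mFourier k x = (AddCircle.toCircle (∑ i, k i • x i) : ℂ) := by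
  have h (s : Finset (Fin n)) : ∏ i ∈ s, fourier (k i) (x i) =
      (AddCircle.toCircle (∑ i ∈ s, k i • x i) : ℂ) := by
    induction s using Finset.induction_on with
    | empty => simp
    | insert a s ha ih =>
      rw [Finset.prod_insert ha, Finset.sum_insert ha, AddCircle.toCircle_add, ih]
      simp [fourier_apply]
  exact h Finset.univ

theorem mFourier_mulMap (k : Fin n → ℤ) (A : Matrix (Fin n) (Fin n) ℤ) (x : Torus n) :
    UnitAddTorus.mFourier k (mulMap A x) = UnitAddTorus.mFourier (k ᵥ* A) x := by
  rw [mFourier_eq_toCircle, mFourier_eq_toCircle]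
  congr 2
  simp only [mulMap, Matrix.vecMul, dotProduct, Finset.sum_smul, Finset.smul_sum, mul_smul]
  exact Finset.sum_comm

theorem fourierCoef_eq_integral_mFourier (μ : Measure (Torus n)) (k : Fin n → ℤ) :
    fourierCoef μ k = ∫ x, UnitAddTorus.mFourier k x ∂μ := rfl

theorem fourierCoef_vecMul {μ : Measure (Torus n)} {A : Matrix (Fin n) (Fin n) ℤ}
    (hA : Measure.map (mulMap A) μ = μ) (k : Fin n → ℤ) :
    fourierCoef μ (k ᵥ* A) = fourierCoef μ k := by
  simp only [fourierCoef_eq_integral_mFourier, ← mFourier_mulMap]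
  conv_rhs => rw [← hA]
  rw [integral_map (continuous_mulMap A).aemeasurable
    (UnitAddTorus.mFourier k).continuous.aestronglyMeasurable]

theorem fourierCoef_zero (μ : Measure (Torus n)) [IsProbabilityMeasure μ] :
    fourierCoef μ 0 = 1 := by
  simp [fourierCoef_eq_integral_mFourier, UnitAddTorus.mFourier_zero]

theorem integrable_mFourier (μ : Measure (Torus n)) [IsFiniteMeasure μ] (k : Fin n → ℤ) :
    Integrable (UnitAddTorus.mFourier k : Torus n → ℂ) μ :=
  (UnitAddTorus.mFourier k).continuous.integrable_of_hasCompactSupport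
    (HasCompactSupport.of_compactSpace _)

theorem fourierCoef_volume {k : Fin n → ℤ} (hk : k ≠ 0) :
    fourierCoef (volume : Measure (Torus n)) k = 0 := by
  obtain ⟨i, hi⟩ := Function.ne_iff.mp hk
  rw [fourierCoef, integral_fintype_prod_volume_eq_prod (fun i (y : AddCircle (1 : ℝ)) =>
    (fourier (k i) y : ℂ))]
  exact Finset.prod_eq_zero (Finset.mem_univ i)
    (integral_eq_zero_of_add_right_eq_neg (fourier_add_half_inv_index hi Fact.out))

theorem ae_sum_smul_eq_zero {μ : Measure (Torus n)} [IsProbabilityMeasure μ] {k : Fin n → ℤ}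
    (hk : fourierCoef μ k = 1) : ∀ᵐ x ∂μ, ∑ i, k i • x i = 0 := by
  have hint := integrable_mFourier μ k
  have hre : Integrable (fun x : Torus n => (UnitAddTorus.mFourier k x).re) μ := hint.re
  have hnorm (x : Torus n) : ‖UnitAddTorus.mFourier k x‖ = 1 := by
    rw [mFourier_eq_toCircle, Circle.norm_coe]
  have h0 : ∫ x, (1 - (UnitAddTorus.mFourier k x).re) ∂μ = 0 := by
    have h1 : ∫ x, (UnitAddTorus.mFourier k x).re ∂μ = 1 := by
      have := integral_re hint
      rw [← fourierCoef_eq_integral_mFourier, hk] at this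
      simpa using this
    rw [integral_sub (integrable_const _) hre, h1]
    simp
  rw [integral_eq_zero_iff_of_nonneg
    (fun x => sub_nonneg.mpr ((Complex.re_le_norm _).trans (hnorm x).le))
    ((integrable_const _).sub hre)] at h0
  filter_upwards [h0] with x hx
  have hre1 : (UnitAddTorus.mFourier k x).re = 1 := by
    simp only [Pi.zero_apply] at hx
    linarith
  have h1 : UnitAddTorus.mFourier k x = 1 := by
    have := Complex.re_eq_norm.mp (hre1.trans (hnorm x).symm)
    exact Complex.ext hre1 (Complex.nonneg_iff.mp this).2.symm
  rw [mFourier_eq_toCircle] at h1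
  apply AddCircle.injective_toCircle (T := (1 : ℝ)) one_ne_zero
  rw [AddCircle.toCircle_zero]
  exact Circle.ext (by simpa using h1)

theorem ext_of_fourierCoef {μ ν : Measure (Torus n)} [IsFiniteMeasure μ] [IsFiniteMeasure ν]
    (h : ∀ k, fourierCoef μ k = fourierCoef ν k) : μ = ν := by
  let S := UnitAddTorus.mFourierSubalgebra (Fin n)
  refine ext_of_forall_mem_subalgebra_integral_eq_of_pseudoEMetric_complete_countable
    (A := S.comap (BoundedContinuousFunction.toContinuousMapStarₐ ℂ)) ?_ fun g hg => ?_
  · intro x y hxy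
    obtain ⟨_, ⟨f, hf, rfl⟩, hne⟩ :=
      UnitAddTorus.mFourierSubalgebra_separatesPoints (d := Fin n) hxy
    exact ⟨_, ⟨f, ⟨BoundedContinuousFunction.mkOfCompact f, hf, rfl⟩, rfl⟩, hne⟩
  · have hg' : g.toContinuousMap ∈ Submodule.span ℂ (Set.range UnitAddTorus.mFourier) := by
      rw [← UnitAddTorus.mFourierSubalgebra_coe]
      exact hg
    have key : ∀ f ∈ Submodule.span ℂ (Set.range (UnitAddTorus.mFourier (d := Fin n))),
        ∫ x, f x ∂μ = ∫ x, f x ∂ν := by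
      intro f hf
      have hI (ρ : Measure (Torus n)) [IsFiniteMeasure ρ] (f : C(Torus n, ℂ)) :
          Integrable f ρ :=
        f.continuous.integrable_of_hasCompactSupport (HasCompactSupport.of_compactSpace _)
      induction hf using Submodule.span_induction with
      | mem f hf =>
        obtain ⟨k, rfl⟩ := hf
        exact h k
      | zero => simp
      | add f g _ _ hf hg =>
        simp only [ContinuousMap.add_apply]
        rw [integral_add (hI μ f) (hI μ g), integral_add (hI ν f) (hI ν g), hf, hg]
      | smul c f _ hf =>
        simp only [ContinuousMap.smul_apply, integral_smul, hf]
    exact key _ hg'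

theorem finite_setOf_smul_eq_zero {d : ℤ} (hd : d ≠ 0) : {x : Torus n | d • x = 0}.Finite := by
  have h1 : {u : AddCircle (1 : ℝ) | d.natAbs • u = 0}.Finite :=
    AddCircle.finite_torsion 1 (Int.natAbs_pos.mpr hd)
  refine (Set.Finite.pi' fun _ : Fin n => h1).subset fun x hx i => ?_
  have hxi : d • x i = 0 := congrFun hx i
  exact natAbs_nsmul_eq_zero.mpr hxi

end Torus

namespace StronglyMixing

variable {X : Type*} [MeasurableSpace X] {T : X → X} {μ : Measure X}

theorem measure_singleton_eq_one [MeasurableSingletonClass X] [IsProbabilityMeasure μ]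
    (h : StronglyMixing T μ) {p : X} (hp : μ {p} ≠ 0) : μ {p} = 1 := by
  have hlim := h {p} {p} (measurableSet_singleton p) (measurableSet_singleton p)
  have hmem (j : ℕ) : μ (T^[j] ⁻¹' {p} ∩ {p}) ∈ ({0, μ {p}} : Set ENNReal) := by
    by_cases hj : T^[j] p = p
    · right
      rw [Set.inter_eq_right.mpr (by simpa using hj)]
      rfl
    · left
      rw [Set.inter_singleton_eq_empty.mpr (by simpa using hj), measure_empty]
  have hcl := (Set.toFinite ({0, μ {p}} : Set ENNReal)).isClosed.mem_of_tendsto hlim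
    (Eventually.of_forall hmem)
  rcases hcl with h0 | h1
  · exact absurd h0 (mul_ne_zero hp hp)
  · exact (ENNReal.mul_eq_left hp (measure_ne_top μ _)).mp h1

theorem exists_eq_dirac [MeasurableSingletonClass X] [IsProbabilityMeasure μ]
    (h : StronglyMixing T μ) {F : Set X} (hF : F.Finite) (hμF : ∀ᵐ x ∂μ, x ∈ F) :
    ∃ x, μ = Measure.dirac x := by
  have hF1 : μ F = 1 := prob_compl_eq_zero_iff hF.measurableSet |>.mp hμF
  obtain ⟨p, -, hp⟩ : ∃ p ∈ F, μ {p} ≠ 0 := by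
    by_contra! hall
    have : μ (⋃ p ∈ F, {p}) = 0 := (measure_biUnion_null_iff hF.countable).mpr hall
    rw [Set.biUnion_of_singleton, hF1] at this
    exact one_ne_zero this
  refine ⟨p, ?_⟩
  have hp1 := h.measure_singleton_eq_one hp
  have hae : id =ᵐ[μ] fun _ => p := (prob_compl_eq_zero_iff (measurableSet_singleton p)).mpr hp1
  have := Measure.map_congr (mβ := inferInstance) hae
  rwa [Measure.map_id, Measure.map_const, measure_univ, one_smul] at this

theorem tendsto_integral_mul [TopologicalSpace X] [SecondCountableTopology X] [CompactSpace X]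
    [TopologicalSpace.PseudoMetrizableSpace X] [BorelSpace X] [IsProbabilityMeasure μ]
    (h : StronglyMixing T μ) (hT : Measurable T) (f g : C(X, ℂ)) :
    Tendsto (fun j => ∫ x, f (T^[j] x) * g x ∂μ) atTop
      (nhds ((∫ x, f x ∂μ) * ∫ x, g x ∂μ)) := by
  have hm (j : ℕ) : Measurable fun x => (T^[j] x, x) := (hT.iterate j).prodMk measurable_id
  let P : ProbabilityMeasure X := ⟨μ, inferInstance⟩
  let ν (j : ℕ) : ProbabilityMeasure (X × X) := P.map (hm j).aemeasurable
  have hν (j : ℕ) : (ν j : Measure (X × X)) = μ.map fun x => (T^[j] x, x) := rfl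
  have hlim : Tendsto ν atTop (nhds (P.prod P)) := by
    refine (isPiSystem_prod (α := X) (β := X)).tendsto_probabilityMeasure_of_tendsto_of_mem
      ?_ ?_ ?_
    · rintro _ ⟨s, hs, t, ht, rfl⟩
      exact hs.prod ht
    · intro u hu x hx
      obtain ⟨s, t, hs, hxs, ht, hxt, hst⟩ := mem_nhds_prod_iff'.mp (hu.mem_nhds hx)
      exact ⟨s ×ˢ t, ⟨s, hs.measurableSet, t, ht.measurableSet, rfl⟩,
        (hs.prod ht).mem_nhds ⟨hxs, hxt⟩, hst⟩
    · rintro _ ⟨s, hs, t, ht, rfl⟩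
      rw [← ENNReal.tendsto_coe]
      simp only [ProbabilityMeasure.ennreal_coeFn_eq_coeFn_toMeasure, hν]
      have hP : (P.prod P : Measure (X × X)) (s ×ˢ t) = μ s * μ t := Measure.prod_prod s t
      rw [hP]
      refine (h s t hs ht).congr fun j => ?_
      rw [Measure.map_apply (hm j) (hs.prod ht)]
      rfl
  rw [ProbabilityMeasure.tendsto_iff_forall_integral_rclike_tendsto ℂ] at hlim
  let F : C(X × X, ℂ) := ⟨fun z => f z.1 * g z.2, by fun_prop⟩
  have hF := hlim (BoundedContinuousFunction.mkOfCompact F)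
  have hprod : ∫ z, F z ∂(μ.prod μ) = (∫ x, f x ∂μ) * ∫ x, g x ∂μ := integral_prod_mul f g
  rw [← hprod]
  refine hF.congr fun j => ?_
  rw [hν, integral_map (hm j).aemeasurable
    (BoundedContinuousFunction.mkOfCompact F).continuous.aestronglyMeasurable]
  rfl

theorem tendsto_fourierCoef {n : ℕ} {A : Matrix (Fin n) (Fin n) ℤ} {μ : Measure (Torus n)}
    [IsProbabilityMeasure μ] (h : StronglyMixing (mulMap A) μ) (k l : Fin n → ℤ) :
    Tendsto (fun j : ℕ => fourierCoef μ (k ᵥ* A ^ j + l)) atTop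
      (nhds (fourierCoef μ k * fourierCoef μ l)) := by
  refine (h.tendsto_integral_mul (continuous_mulMap A).measurable
    (UnitAddTorus.mFourier k) (UnitAddTorus.mFourier l)).congr fun j => ?_
  simp only [fourierCoef_eq_integral_mFourier, UnitAddTorus.mFourier_add, ← mFourier_mulMap,
    mulMap_pow]

end StronglyMixing

theorem fourierCoef_vecMul_eq_one {n : ℕ} {A B : Matrix (Fin n) (Fin n) ℤ}
    {μ : Measure (Torus n)} [IsProbabilityMeasure μ] (hsm : StronglyMixing (mulMap A) μ)
    {E : Set ℕ} (hE : E.Infinite) (hinv : ∀ j ∈ E, Measure.map (mulMap (A ^ j + B)) μ = μ)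
    {k : Fin n → ℤ} (hk : fourierCoef μ k ≠ 0) : fourierCoef μ (k ᵥ* B) = 1 := by
  have hfreq : ∃ᶠ j in atTop, fourierCoef μ (k ᵥ* A ^ j + k ᵥ* B) ∈ ({fourierCoef μ k} : Set ℂ) :=
    (Nat.frequently_atTop_iff_infinite.mpr hE).mono fun j hj => by
      rw [← Matrix.vecMul_add, fourierCoef_vecMul (hinv j hj)]
      rfl
  have h := isClosed_singleton.mem_of_frequently_of_tendsto hfreq
    (hsm.tendsto_fourierCoef k (k ᵥ* B))
  exact (mul_eq_left₀ hk).mp h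

theorem stmt3 {n : ℕ} (hn : 0 < n) (A : Matrix (Fin n) (Fin n) ℤ)
    (μ : Measure (Torus n)) [IsProbabilityMeasure μ]
    (hinvA : Measure.map (mulMap A) μ = μ)
    (hsm : StronglyMixing (mulMap A) μ)
    (B : Fin n → Matrix (Fin n) (Fin n) ℤ)
    (hBGL : ∀ i, IsUnit (B i).det)
    (hSI : StronglyIndependent B)
    (E : Set ℕ) (hE : E.Infinite)
    (hinv : ∀ j ∈ E, ∀ i : Fin n, Measure.map (mulMap (A ^ j + B i)) μ = μ) :
    (∃ x : Torus n, μ = Measure.dirac x) ∨ μ = volume := by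
  by_cases hall : ∀ k : Fin n → ℤ, k ≠ 0 → fourierCoef μ k = 0
  · right
    refine ext_of_fourierCoef fun k => ?_
    by_cases hk : k = 0
    · have : IsProbabilityMeasure (volume : Measure (AddCircle (1 : ℝ))) :=
        ⟨UnitAddCircle.measure_univ⟩
      rw [hk, fourierCoef_zero, fourierCoef_zero]
    · rw [hall k hk, fourierCoef_volume hk]
  · left
    push Not at hall
    obtain ⟨k, hk, hμk⟩ := hall
    let L : Matrix (Fin n) (Fin n) ℤ := Matrix.of fun i => k ᵥ* B i
    have hdet : L.det ≠ 0 := by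
      have hunit : IsUnit (L.map (Int.castRingHom ℝ)) :=
        Matrix.linearIndependent_rows_iff_isUnit.mp (hSI k hk)
      have hne := ((Matrix.isUnit_iff_isUnit_det _).mp hunit).ne_zero
      rw [← RingHom.mapMatrix_apply, ← RingHom.map_det] at hne
      exact fun h0 => hne (by rw [h0, map_zero])
    have hae : ∀ᵐ x ∂μ, mulMap L x = 0 := by
      have (i : Fin n) : ∀ᵐ x ∂μ, ∑ j, (k ᵥ* B i) j • x j = 0 :=
        ae_sum_smul_eq_zero (fourierCoef_vecMul_eq_one hsm hE (fun j hj => hinv j hj i) hμk)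
      filter_upwards [ae_all_iff.mpr this] with x hx
      exact funext hx
    refine hsm.exists_eq_dirac (finite_setOf_smul_eq_zero hdet) ?_
    filter_upwards [hae] with x hx
    rw [← mulMap_smul_one, ← Matrix.adjugate_mul, mulMap_mul, hx,
      mulMap_zero_right]
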